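/- arXiv:1411.5705 — 8 statements merged into one kernel-verified Lean document; each statement's English description precedes it below -/
import Mathlib

section
/- There exists a continuous map H : ℝ × GL(n, ℂ) → GL(n, ℂ) (where GL(n, ℂ) carries the subspace topology from the n×n complex matrices) such that: (i) H(1, g) = g for all g; (ii) for every g, the matrix H(0, g) lies in the unitary group U(n); (iii) H(t, u) = u for every t ∈ ℝ and every u ∈ GL(n, ℂ) whose underlying matrix is unitary; and (iv) H(t, u·g) = u·H(t, g) for every unitary u, every g ∈ GL(n, ℂ) and every t ∈ ℝ. In other words, U(n) is a strong deformation retract of GL(n, ℂ), equivariantly for the left U(n)-action (the retraction in the paper is h(g,t) = g·(gᴴg)^{(t−1)/2}). -/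
section CStarAlgebra

variable {A : Type*} [CStarAlgebra A]

/-- The flow `(t, g) ↦ g * (star g * g) ^ ((t - 1) / 2)`, with the power of the strictly positive
element `star g * g` written as an exponential of its logarithm. -/
noncomputable def polarFlow (t : ℝ) (g : A) : A :=
  g * NormedSpace.exp (((t - 1) / 2) • CFC.log (star g * g))

lemma isSelfAdjoint_smul_log (r : ℝ) (a : A) : IsSelfAdjoint (r • CFC.log a) :=
  (IsSelfAdjoint.all r).smul IsSelfAdjoint.log

lemma isUnit_polarFlow (t : ℝ) {g : A} (hg : IsUnit g) : IsUnit (polarFlow t g) := by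
  let _ : NormedAlgebra ℚ A := NormedAlgebra.restrictScalars ℚ ℂ A
  exact hg.mul (NormedSpace.isUnit_exp _)

lemma continuous_polarFlow :
    Continuous fun p : ℝ × {g : A // IsUnit g} ↦ polarFlow p.1 (p.2 : A) := by
  let _ : NormedAlgebra ℚ A := NormedAlgebra.restrictScalars ℚ ℂ A
  have hlog : Continuous fun g : {g : A // IsUnit g} ↦ CFC.log (star (g : A) * g) :=
    CFC.continuousOn_log.comp_continuous (by fun_prop) fun g ↦
      ⟨IsSelfAdjoint.star_mul_self _, g.2.star.mul g.2⟩
  have hscale : Continuous fun p : ℝ × {g : A // IsUnit g} ↦ (p.1 - 1) / 2 := by fun_prop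
  exact (continuous_subtype_val.comp continuous_snd).mul
    (NormedSpace.exp_continuous.comp (hscale.smul (hlog.comp continuous_snd)))

lemma polarFlow_one (g : A) : polarFlow 1 g = g := by
  simp [polarFlow]

lemma polarFlow_of_mem_unitary (t : ℝ) {u : A} (hu : u ∈ unitary A) : polarFlow t u = u := by
  simp [polarFlow, Unitary.star_mul_self_of_mem hu]

lemma polarFlow_unitary_mul (t : ℝ) {u : A} (hu : u ∈ unitary A) (g : A) :
    polarFlow t (u * g) = u * polarFlow t g := by
  have h : star (u * g) * (u * g) = star g * g := by
    rw [star_mul, mul_assoc, ← mul_assoc (star u), Unitary.star_mul_self_of_mem hu, one_mul]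
  rw [polarFlow, polarFlow, h, mul_assoc]

lemma polarFlow_zero_mem_unitary [PartialOrder A] [StarOrderedRing A] {g : A} (hg : IsUnit g) :
    polarFlow 0 g ∈ unitary A := by
  let _ : NormedAlgebra ℚ A := NormedAlgebra.restrictScalars ℚ ℂ A
  have hp : IsStrictlyPositive (star g * g) :=
    IsStrictlyPositive.iff_of_unital.2 ⟨star_mul_self_nonneg g, hg.star.mul hg⟩
  set L := CFC.log (star g * g) with hL
  have hexp : NormedSpace.exp L = star g * g := CFC.exp_log _ hp
  set e := NormedSpace.exp (((0 - 1 : ℝ) / 2) • L) with he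
  have hstar : star e = e := by
    rw [he, NormedSpace.star_exp, (isSelfAdjoint_smul_log _ _).star_eq]
  have hadd (r s : ℝ) : NormedSpace.exp (r • L) * NormedSpace.exp (s • L) =
      NormedSpace.exp ((r + s) • L) := by
    rw [add_smul, NormedSpace.exp_add_of_commute (((Commute.refl L).smul_left r).smul_right s)]
  have h : star (polarFlow 0 g) * polarFlow 0 g = 1 := by
    calc star (polarFlow 0 g) * polarFlow 0 g = e * (star g * g) * e := by
          rw [polarFlow, ← hL, ← he, star_mul, hstar]; simp only [mul_assoc]
      _ = e * NormedSpace.exp ((1 : ℝ) • L) * e := by rw [one_smul, hexp]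
      _ = 1 := by rw [he, hadd, hadd]; norm_num
  exact (isUnit_polarFlow 0 hg).mem_unitary_iff_star_mul_self.2 h

end CStarAlgebra

open scoped Matrix.Norms.L2Operator MatrixOrder in

/-- The unitary group `U(n)` is a strong deformation retract of `GL(n, ℂ)`
(realized as the subspace of invertible matrices inside `Matrix (Fin n) (Fin n) ℂ`),
equivariantly for the left `U(n)`-action. -/
theorem unitary_equivariant_deformation_retract_of_GL (n : ℕ) :
    ∃ H : ℝ × {g : Matrix (Fin n) (Fin n) ℂ // IsUnit g} →
        {g : Matrix (Fin n) (Fin n) ℂ // IsUnit g},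
      Continuous H ∧
      (∀ g : {g : Matrix (Fin n) (Fin n) ℂ // IsUnit g}, H (1, g) = g) ∧
      (∀ g : {g : Matrix (Fin n) (Fin n) ℂ // IsUnit g},
        (H (0, g) : Matrix (Fin n) (Fin n) ℂ) ∈ Matrix.unitaryGroup (Fin n) ℂ) ∧
      (∀ (t : ℝ) (u : {g : Matrix (Fin n) (Fin n) ℂ // IsUnit g}),
        (u : Matrix (Fin n) (Fin n) ℂ) ∈ Matrix.unitaryGroup (Fin n) ℂ → H (t, u) = u) ∧
      (∀ (t : ℝ) (u : Matrix.unitaryGroup (Fin n) ℂ)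
        (g : {g : Matrix (Fin n) (Fin n) ℂ // IsUnit g})
        (h : IsUnit ((u : Matrix (Fin n) (Fin n) ℂ) * (g : Matrix (Fin n) (Fin n) ℂ))),
        (H (t, ⟨(u : Matrix (Fin n) (Fin n) ℂ) * (g : Matrix (Fin n) (Fin n) ℂ), h⟩) :
            Matrix (Fin n) (Fin n) ℂ) =
          (u : Matrix (Fin n) (Fin n) ℂ) * (H (t, g) : Matrix (Fin n) (Fin n) ℂ)) := by
  refine ⟨fun p ↦ ⟨polarFlow p.1 p.2, isUnit_polarFlow p.1 p.2.2⟩,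
    continuous_polarFlow.subtype_mk _, fun g ↦ Subtype.ext (polarFlow_one _),
    fun g ↦ polarFlow_zero_mem_unitary g.2,
    fun t u hu ↦ Subtype.ext (polarFlow_of_mem_unitary t hu),
    fun t u g _ ↦ polarFlow_unitary_mul t u.2 g⟩
end

section
/- The multiplication map (u, p) ↦ u·p from U(n) × {p : Matrix n n ℂ // p is positive definite} to {g : Matrix n n ℂ // g is invertible} is a homeomorphism, where all three sets carry the subspace topology from Matrix n n ℂ; that is, it is a bijection and both it and its inverse are continuous. -/
open scoped ComplexOrder

namespace Matrix

open scoped MatrixOrder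

variable {ι : Type*} [Fintype ι] [DecidableEq ι]

open scoped Matrix.Norms.L2Operator in
/-- The matrix absolute value `|g| = √(gᴴ g)` depends continuously on `g`. -/
theorem continuous_cfcAbs : Continuous (CFC.abs : Matrix ι ι ℂ → Matrix ι ι ℂ) :=
  CFC.continuous_abs

/-- The absolute value of an invertible matrix is positive definite. -/
theorem posDef_cfcAbs {g : Matrix ι ι ℂ} (hg : IsUnit g) : (CFC.abs g).PosDef := by
  refine (nonneg_iff_posSemidef.mp (CFC.abs_nonneg g)).posDef_iff_isUnit.mpr ?_
  exact (CFC.isUnit_sqrt_iff (star g * g) (star_mul_self_nonneg g)).mpr (hg.star.mul hg)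

/-- The unitary factor `g |g|⁻¹` of an invertible matrix. -/
theorem mul_inv_cfcAbs_mem_unitaryGroup {g : Matrix ι ι ℂ} (hg : IsUnit g) :
    g * (CFC.abs g)⁻¹ ∈ unitaryGroup ι ℂ := by
  have hp := posDef_cfcAbs hg
  have hdet := (isUnit_iff_isUnit_det _).mp hp.isUnit
  rw [mem_unitaryGroup_iff', star_mul, star_eq_conjTranspose (CFC.abs g)⁻¹,
    hp.inv.isHermitian.eq, mul_assoc, ← mul_assoc (star g), ← CFC.abs_mul_abs, mul_assoc,
    mul_nonsing_inv _ hdet, mul_one, nonsing_inv_mul _ hdet]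

/-- The absolute value of `u p` is `p` for `u` unitary and `p` positive semidefinite. -/
theorem cfcAbs_unitary_mul {u p : Matrix ι ι ℂ} (hu : u ∈ unitaryGroup ι ℂ) (hp : p.PosSemidef) :
    CFC.abs (u * p) = p := by
  refine CFC.sqrt_unique ?_ hp.nonneg
  rw [star_mul, mul_assoc, ← mul_assoc (star u), mem_unitaryGroup_iff'.mp hu, one_mul,
    star_eq_conjTranspose, hp.isHermitian.eq]

theorem continuous_inv_of_isUnit {X : Type*} [TopologicalSpace X] {f : X → Matrix ι ι ℂ}
    (hf : Continuous f) (hu : ∀ x, IsUnit (f x)) : Continuous fun x ↦ (f x)⁻¹ := by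
  simp only [inv_def, Ring.inverse_eq_inv']
  exact (hf.matrix_det.inv₀ fun x ↦ ((isUnit_iff_isUnit_det _).mp (hu x)).ne_zero).smul
    hf.matrix_adjugate

/-- The polar decomposition of invertible complex matrices, as a homeomorphism. -/
noncomputable def polarHomeomorph (ι : Type*) [Fintype ι] [DecidableEq ι] :
    (unitaryGroup ι ℂ × {p : Matrix ι ι ℂ // p.PosDef}) ≃ₜ {g : Matrix ι ι ℂ // IsUnit g} where
  toFun x := ⟨x.1 * x.2, (Unitary.isUnit_coe (U := x.1)).mul x.2.2.isUnit⟩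
  invFun g := (⟨g * (CFC.abs g.1)⁻¹, mul_inv_cfcAbs_mem_unitaryGroup g.2⟩,
    ⟨CFC.abs g.1, posDef_cfcAbs g.2⟩)
  left_inv := by
    rintro ⟨⟨u, hu⟩, ⟨p, hp⟩⟩
    have habs := cfcAbs_unitary_mul hu hp.posSemidef
    refine Prod.ext (Subtype.ext ?_) (Subtype.ext habs)
    simp only [habs]
    exact mul_nonsing_inv_cancel_right _ _ ((isUnit_iff_isUnit_det _).mp hp.isUnit)
  right_inv g := Subtype.ext <|
    nonsing_inv_mul_cancel_right _ _ ((isUnit_iff_isUnit_det _).mp (posDef_cfcAbs g.2).isUnit)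
  continuous_toFun := by
    refine Continuous.subtype_mk ?_ _
    exact (continuous_subtype_val.comp continuous_fst).mul
      (continuous_subtype_val.comp continuous_snd)
  continuous_invFun := by
    have habs : Continuous fun g : {g : Matrix ι ι ℂ // IsUnit g} ↦ CFC.abs g.1 :=
      continuous_cfcAbs.comp continuous_subtype_val
    refine Continuous.prodMk (Continuous.subtype_mk ?_ _) (habs.subtype_mk _)
    exact continuous_subtype_val.mul
      (continuous_inv_of_isUnit habs fun g ↦ (posDef_cfcAbs g.2).isUnit)

end Matrix

/-- The multiplication map `(u, p) ↦ u * p` is a homeomorphism from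
`U(n) × {positive definite matrices}` onto `{invertible matrices}`, all carrying the
subspace topology from `Matrix (Fin n) (Fin n) ℂ`. -/
theorem polar_decomposition_homeomorph (n : ℕ) :
    ∃ φ : (Matrix.unitaryGroup (Fin n) ℂ × {p : Matrix (Fin n) (Fin n) ℂ // p.PosDef}) ≃ₜ
        {g : Matrix (Fin n) (Fin n) ℂ // IsUnit g},
      ∀ (u : Matrix.unitaryGroup (Fin n) ℂ) (p : {p : Matrix (Fin n) (Fin n) ℂ // p.PosDef}),
        (φ (u, p) : Matrix (Fin n) (Fin n) ℂ) =
          (u : Matrix (Fin n) (Fin n) ℂ) * (p : Matrix (Fin n) (Fin n) ℂ) :=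
  ⟨Matrix.polarHomeomorph (Fin n), fun _ _ ↦ rfl⟩
end

section
/- Dyson series solution of a linear ODE in a Banach algebra: let E be a real Banach algebra and A : ℝ → E continuous. Define F₀(x) = 1 and recursively F_{n+1}(x) = ∫₀ˣ Fₙ(t)·A(t) dt. Then for every x ∈ ℝ the series Σ_{n≥0} Fₙ(x) converges absolutely in E, and the function g(x) := Σ_{n≥0} Fₙ(x) satisfies g(0) = 1 and has derivative g(x)·A(x) at every x ∈ ℝ (i.e. HasDerivAt g (g(x) * A(x)) x for all x). -/
open MeasureTheory intervalIntegral

open scoped Nat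

lemma exists_norm_le_of_abs_le {E : Type*} [SeminormedAddCommGroup E] {A : ℝ → E}
    (hA : Continuous A) (R : ℝ) :
    ∃ M, ∀ x, |x| ≤ R → ‖A x‖ ≤ M := by
  obtain ⟨M, hM⟩ := (isCompact_Icc (a := -R) (b := R)).exists_bound_of_continuousOn
    hA.continuousOn
  exact ⟨M, fun x hx => hM x (abs_le.mp hx)⟩

section DysonSeries

variable {E : Type*} [NormedRing E] [NormedAlgebra ℝ E] {A : ℝ → E} {F : ℕ → ℝ → E}

lemma continuous_dyson_term (hA : Continuous A) (hF0 : ∀ x : ℝ, F 0 x = 1)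
    (hFs : ∀ (n : ℕ) (x : ℝ), F (n + 1) x = ∫ t in (0 : ℝ)..x, F n t * A t) (n : ℕ) :
    Continuous (F n) := by
  induction n with
  | zero =>
    rw [funext hF0]
    exact continuous_const
  | succ n ih =>
    rw [funext (hFs n)]
    exact intervalIntegral.continuous_primitive
      (fun a b => (ih.mul hA).intervalIntegrable a b) 0

lemma hasDerivAt_dyson_term_succ [CompleteSpace E] (hA : Continuous A)
    (hF0 : ∀ x : ℝ, F 0 x = 1)
    (hFs : ∀ (n : ℕ) (x : ℝ), F (n + 1) x = ∫ t in (0 : ℝ)..x, F n t * A t) (n : ℕ) (x : ℝ) :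
    HasDerivAt (F (n + 1)) (F n x * A x) x := by
  rw [funext (hFs n)]
  exact ((continuous_dyson_term hA hF0 hFs n).mul hA).integral_hasStrictDerivAt 0 x |>.hasDerivAt

lemma norm_dyson_term_le (hA : Continuous A) (hF0 : ∀ x : ℝ, F 0 x = 1)
    (hFs : ∀ (n : ℕ) (x : ℝ), F (n + 1) x = ∫ t in (0 : ℝ)..x, F n t * A t)
    {R M : ℝ} (hM : ∀ x, |x| ≤ R → ‖A x‖ ≤ M) (n : ℕ) {x : ℝ} (hx : |x| ≤ R) :
    ‖F n x‖ ≤ ‖(1 : E)‖ * ((M * |x|) ^ n / n !) := by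
  have hM0 : 0 ≤ M := (norm_nonneg _).trans (hM x hx)
  induction n generalizing x with
  | zero => simp [hF0]
  | succ n ih =>
    have hbound : ∀ t ∈ Set.uIoc 0 x,
        ‖F n t * A t‖ ≤ ‖(1 : E)‖ * (M ^ (n + 1) / n !) * |t - 0| ^ n := by
      intro t ht
      have htR : |t| ≤ R := by
        have := Set.abs_sub_left_of_mem_uIcc (Set.uIoc_subset_uIcc ht)
        simp only [sub_zero] at this
        exact this.trans hx
      calc ‖F n t * A t‖ ≤ ‖F n t‖ * ‖A t‖ := norm_mul_le _ _
        _ ≤ ‖(1 : E)‖ * ((M * |t|) ^ n / n !) * M :=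
          mul_le_mul (ih htR) (hM t htR) (norm_nonneg _) (by positivity)
        _ = ‖(1 : E)‖ * (M ^ (n + 1) / n !) * |t - 0| ^ n := by
          rw [sub_zero]
          ring
    rw [hFs]
    calc ‖∫ t in (0 : ℝ)..x, F n t * A t‖
        ≤ ∫ t in Set.uIoc 0 x, ‖F n t * A t‖ :=
          intervalIntegral.norm_integral_le_integral_norm_uIoc
      _ ≤ ∫ t in Set.uIoc 0 x, ‖(1 : E)‖ * (M ^ (n + 1) / n !) * |t - 0| ^ n := by
          refine setIntegral_mono_on ?_ ?_ measurableSet_uIoc hbound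
          · exact (((continuous_dyson_term hA hF0 hFs n).mul hA).norm.intervalIntegrable 0 x).def'
          · exact (Continuous.intervalIntegrable (by fun_prop) 0 x).def'
      _ = ‖(1 : E)‖ * ((M * |x|) ^ (n + 1) / (n + 1)!) := by
          rw [MeasureTheory.integral_const_mul, integral_pow_abs_sub_uIoc, sub_zero, Nat.factorial_succ]
          push_cast
          field_simp
          ring

lemma summable_norm_dyson (hA : Continuous A) (hF0 : ∀ x : ℝ, F 0 x = 1)
    (hFs : ∀ (n : ℕ) (x : ℝ), F (n + 1) x = ∫ t in (0 : ℝ)..x, F n t * A t) (x : ℝ) :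
    Summable fun n : ℕ => ‖F n x‖ := by
  obtain ⟨M, hM⟩ := exists_norm_le_of_abs_le hA |x|
  exact .of_nonneg_of_le (fun _ => norm_nonneg _)
    (fun n => norm_dyson_term_le hA hF0 hFs hM n le_rfl)
    ((Real.summable_pow_div_factorial (M * |x|)).mul_left _)

lemma hasDerivAt_tsum_dyson [CompleteSpace E] (hA : Continuous A) (hF0 : ∀ x : ℝ, F 0 x = 1)
    (hFs : ∀ (n : ℕ) (x : ℝ), F (n + 1) x = ∫ t in (0 : ℝ)..x, F n t * A t) (x : ℝ) :
    HasDerivAt (fun y : ℝ => ∑' n : ℕ, F n y) ((∑' n : ℕ, F n x) * A x) x := by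
  have hsum (y : ℝ) : Summable fun n => F n y := (summable_norm_dyson hA hF0 hFs y).of_norm
  set R := |x| + 1
  obtain ⟨M, hM⟩ := exists_norm_le_of_abs_le hA R
  have hM0 : 0 ≤ M := (norm_nonneg _).trans (hM x (by simp [R]))
  have hxR : x ∈ Set.Ioo (-R) R := abs_lt.mp (by simp [R])
  have hu : Summable fun n : ℕ => ‖(1 : E)‖ * ((M * R) ^ n / n !) * M :=
    ((Real.summable_pow_div_factorial (M * R)).mul_left _).mul_right _
  have htail : HasDerivAt (fun y => ∑' n, F (n + 1) y) (∑' n, F n x * A x) x := by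
    refine hasDerivAt_tsum_of_isPreconnected hu isOpen_Ioo isPreconnected_Ioo
      (fun n y _ => hasDerivAt_dyson_term_succ hA hF0 hFs n y) (fun n y hy => ?_) hxR
      ((summable_nat_add_iff 1).mpr (hsum x)) hxR
    have hyR : |y| ≤ R := (abs_lt.mpr hy).le
    calc ‖F n y * A y‖ ≤ ‖F n y‖ * ‖A y‖ := norm_mul_le _ _
      _ ≤ ‖(1 : E)‖ * ((M * |y|) ^ n / n !) * M :=
        mul_le_mul (norm_dyson_term_le hA hF0 hFs hM n hyR) (hM y hyR) (norm_nonneg _)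
          (by positivity)
      _ ≤ ‖(1 : E)‖ * ((M * R) ^ n / n !) * M := by gcongr
  rw [← (hsum x).tsum_mul_right]
  have hsplit : (fun y => ∑' n, F n y) = fun y => 1 + ∑' n, F (n + 1) y := by
    funext y
    rw [(hsum y).tsum_eq_zero_add, hF0]
  rw [hsplit]
  exact htail.const_add 1

end DysonSeries

/-- Dyson series solution of the linear ODE `g' = g·A` in a real Banach algebra:
with `F₀ = 1` and `F_{n+1}(x) = ∫₀ˣ Fₙ(t)·A(t) dt`, the series `∑ₙ Fₙ(x)` converges
absolutely for every `x`, its sum `g` satisfies `g(0) = 1` and `g'(x) = g(x)·A(x)`. -/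
theorem dyson_series_solves_linear_ode
    (E : Type*) [NormedRing E] [NormedAlgebra ℝ E] [CompleteSpace E]
    (A : ℝ → E) (hA : Continuous A)
    (F : ℕ → ℝ → E) (hF0 : ∀ x : ℝ, F 0 x = 1)
    (hFs : ∀ (n : ℕ) (x : ℝ), F (n + 1) x = ∫ t in (0 : ℝ)..x, F n t * A t) :
    (∀ x : ℝ, Summable fun n : ℕ => ‖F n x‖) ∧
    (∑' n : ℕ, F n 0) = 1 ∧
    ∀ x : ℝ, HasDerivAt (fun y : ℝ => ∑' n : ℕ, F n y) ((∑' n : ℕ, F n x) * A x) x := by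
  refine ⟨summable_norm_dyson hA hF0 hFs, ?_, hasDerivAt_tsum_dyson hA hF0 hFs⟩
  rw [tsum_eq_single 0, hF0]
  intro n hn
  obtain ⟨m, rfl⟩ := Nat.exists_eq_succ_of_ne_zero hn
  rw [Nat.succ_eq_add_one, hFs, intervalIntegral.integral_same]
end

section
/- Uniqueness and invertibility for linear ODEs in a Banach algebra: let E be a real Banach algebra and A : ℝ → E continuous. (i) If g₁, g₂ : ℝ → E both satisfy HasDerivAt gᵢ (gᵢ(x) * A(x)) x for all x ∈ ℝ and g₁(0) = g₂(0), then g₁ = g₂. (ii) If g : ℝ → E satisfies HasDerivAt g (g(x) * A(x)) x for all x and g(0) = 1, then g(x) is a unit of E for every x ∈ ℝ. -/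
section LinearODE

open Set Metric
open scoped NNReal Topology

theorem lipschitzWith_mul_right_of_norm_le {E : Type*} [NormedRing E] {c : E} {K : ℝ≥0} (hc : ‖c‖ ≤ K) :
    LipschitzWith K fun y : E ↦ y * c :=
  LipschitzWith.of_dist_le_mul fun y z ↦ by
    rw [dist_eq_norm, dist_eq_norm, ← sub_mul, mul_comm (K : ℝ)]
    exact (norm_mul_le _ _).trans (by gcongr)

variable {E : Type*} [NormedRing E] [NormedAlgebra ℝ E] {A : ℝ → E}

/-- Solutions of `g' = g * A` on an open interval that agree at one point are equal. -/
theorem eqOn_Ioo_of_hasDerivAt_mul (hA : Continuous A) {g₁ g₂ : ℝ → E} {a b t₀ : ℝ}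
    (ht₀ : t₀ ∈ Ioo a b) (h₁ : ∀ t ∈ Ioo a b, HasDerivAt g₁ (g₁ t * A t) t)
    (h₂ : ∀ t ∈ Ioo a b, HasDerivAt g₂ (g₂ t * A t) t) (h : g₁ t₀ = g₂ t₀) :
    EqOn g₁ g₂ (Ioo a b) := by
  obtain ⟨C, hC⟩ := isCompact_Icc.exists_bound_of_continuousOn (hA.continuousOn (s := Icc a b))
  refine ODE_solution_unique_of_mem_Ioo (v := fun t y ↦ y * A t) (s := fun _ ↦ univ)
    (K := C.toNNReal) (fun t ht ↦ ?_) ht₀ (fun t ht ↦ ⟨h₁ t ht, mem_univ _⟩)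
    (fun t ht ↦ ⟨h₂ t ht, mem_univ _⟩) h
  exact (lipschitzWith_mul_right_of_norm_le
    ((hC t (Ioo_subset_Icc_self ht)).trans (Real.le_coe_toNNReal C))).lipschitzOnWith

/-- Local existence of solutions of `g' = g * A` with prescribed value at a point. -/
theorem exists_hasDerivAt_mul_of_continuous [CompleteSpace E] (hA : Continuous A) (t₀ : ℝ)
    (x₀ : E) :
    ∃ h : ℝ → E, h t₀ = x₀ ∧ ∃ ε > 0, ∀ t ∈ Ioo (t₀ - ε) (t₀ + ε),
      HasDerivAt h (h t * A t) t := by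
  obtain ⟨δ, hδ, hball⟩ := Metric.eventually_nhds_iff_ball.mp
    (hA.norm.continuousAt.eventually_lt continuousAt_const (lt_add_one ‖A t₀‖))
  set K : ℝ≥0 := ‖A t₀‖₊ + 1
  set L : ℝ≥0 := (‖x₀‖₊ + 1) * K
  have hL : 0 < L := by positivity
  set ε : ℝ := min (δ / 2) (1 / L)
  have hε : 0 < ε := by positivity
  have hK : ∀ t ∈ Icc (t₀ - ε) (t₀ + ε), ‖A t‖ ≤ K := fun t ht ↦ by
    refine (hball t ?_).le
    have : ε ≤ δ / 2 := min_le_left _ _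
    rw [mem_ball, Real.dist_eq, abs_lt]
    constructor <;> linarith [ht.1, ht.2]
  have hPL : IsPicardLindelof (fun t (y : E) ↦ y * A t) (tmin := t₀ - ε) (tmax := t₀ + ε)
      ⟨t₀, by simp [hε.le]⟩ x₀ 1 0 L K :=
    { lipschitzOnWith := fun t ht ↦ (lipschitzWith_mul_right_of_norm_le (hK t ht)).lipschitzOnWith
      continuousOn := fun x _ ↦ (continuous_const.mul hA).continuousOn
      norm_le := fun t ht x hx ↦ by
        have hx' : ‖x‖ ≤ ‖x₀‖ + 1 := norm_le_of_mem_closedBall hx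
        exact (norm_mul_le _ _).trans (mul_le_mul hx' (hK t ht) (norm_nonneg _)
            (add_nonneg (norm_nonneg _) zero_le_one))
      mul_max_le := by
        have : ε * L ≤ 1 := (le_div_iff₀ (by positivity)).mp (min_le_right _ _)
        simpa [mul_comm] using this }
  obtain ⟨h, h₀, hh⟩ := hPL.exists_eq_forall_mem_Icc_hasDerivWithinAt₀
  exact ⟨h, h₀, ε, hε, fun t ht ↦
    (hh t (Ioo_subset_Icc_self ht)).hasDerivAt (Icc_mem_nhds ht.1 ht.2)⟩

/-- The set of times at which a solution of `g' = g * A` is invertible is closed. -/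
theorem isClosed_setOf_isUnit_of_hasDerivAt_mul [CompleteSpace E] (hA : Continuous A) {g : ℝ → E}
    (hg : ∀ t, HasDerivAt g (g t * A t) t) : IsClosed {t | IsUnit (g t)} := by
  refine isClosed_of_closure_subset fun t₀ ht₀ ↦ ?_
  obtain ⟨h, h₀, ε, hε, hh⟩ := exists_hasDerivAt_mul_of_continuous hA t₀ 1
  have hmem : t₀ ∈ Ioo (t₀ - ε) (t₀ + ε) := by simp [hε]
  have hunit : ∀ᶠ t in 𝓝 t₀, IsUnit (h t) :=
    (hh t₀ hmem).continuousAt.eventually (Units.isOpen.mem_nhds (by simp [h₀]))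
  obtain ⟨t, ⟨⟨u, hu⟩, ht⟩, v, hv⟩ :=
    mem_closure_iff_nhds.mp ht₀ _ (Filter.inter_mem hunit (Ioo_mem_nhds hmem.1 hmem.2))
  have key := eqOn_Ioo_of_hasDerivAt_mul hA (g₁ := g) (g₂ := fun s ↦ ↑(v * u⁻¹) * h s) ht
    (fun s _ ↦ hg s)
    (fun s hs ↦ by simpa only [mul_assoc] using (hh s hs).const_mul (↑(v * u⁻¹) : E))
    (by simp [← hu, ← hv])
  simp [key hmem, h₀]

end LinearODE


/-- Uniqueness and invertibility for solutions of the linear ODE `g' = g·A` in a real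
Banach algebra: solutions are determined by their value at `0`, and a solution with
`g(0) = 1` takes values in the units of `E`. -/
theorem linear_ode_unique_and_units
    (E : Type*) [NormedRing E] [NormedAlgebra ℝ E] [CompleteSpace E]
    (A : ℝ → E) (hA : Continuous A) :
    (∀ g₁ g₂ : ℝ → E, (∀ x : ℝ, HasDerivAt g₁ (g₁ x * A x) x) →
      (∀ x : ℝ, HasDerivAt g₂ (g₂ x * A x) x) → g₁ 0 = g₂ 0 → g₁ = g₂) ∧
    (∀ g : ℝ → E, (∀ x : ℝ, HasDerivAt g (g x * A x) x) → g 0 = 1 →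
      ∀ x : ℝ, IsUnit (g x)) := by
  refine ⟨fun g₁ g₂ h₁ h₂ h ↦ funext fun x ↦ ?_, fun g hg h₀ x ↦ ?_⟩
  · refine eqOn_Ioo_of_hasDerivAt_mul hA (a := -|x| - 1) (b := |x| + 1) (t₀ := 0) ?_
      (fun t _ ↦ h₁ t) (fun t _ ↦ h₂ t) h ?_
    · constructor <;> linarith [abs_nonneg x]
    · constructor <;> linarith [neg_abs_le x, le_abs_self x]
  · have hcont : Continuous g := continuous_iff_continuousAt.mpr fun t ↦ (hg t).continuousAt
    have hclopen : IsClopen {t | IsUnit (g t)} :=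
      ⟨isClosed_setOf_isUnit_of_hasDerivAt_mul hA hg, Units.isOpen.preimage hcont⟩
    exact Set.eq_univ_iff_forall.mp (hclopen.eq_univ ⟨0, by simp [h₀]⟩) x
end

section
/- Holomorphic solution of a linear matrix ODE on the disc: let A : ℂ → Matrix n n ℂ be complex-differentiable on the open unit ball B = {z : |z| < 1}. Then there exists a function g : ℂ → Matrix n n ℂ, complex-differentiable on B, such that g(0) = 1, g has derivative g(z)·A(z) at every z ∈ B (HasDerivAt g (g(z) * A(z)) z), and g(z) is an invertible matrix for every z ∈ B; moreover g is unique on B: any two functions with these properties (even without the invertibility condition) agree on B. -/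
attribute [local instance] Matrix.linftyOpNormedRing Matrix.linftyOpNormedAlgebra

section LinearODE

open Metric Set
open scoped Nat

variable {E : Type*} [NormedAddCommGroup E] [NormedSpace ℂ E]

/-- A function vanishing at the origin whose derivative is `O(‖w‖ ^ k)` on a ball is bounded
by the corresponding multiple of `‖z‖ ^ (k + 1)`. -/
theorem norm_le_of_norm_hasDerivAt_le_pow {f f' : ℂ → E} {r C : ℝ} {k : ℕ}
    (hf : ∀ z ∈ ball (0 : ℂ) r, HasDerivAt f (f' z) z) (hf₀ : f 0 = 0)
    (bound : ∀ z ∈ ball (0 : ℂ) r, ‖f' z‖ ≤ C * ‖z‖ ^ k) {z : ℂ} (hz : z ∈ ball (0 : ℂ) r) :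
    ‖f z‖ ≤ C * ‖z‖ ^ (k + 1) / (k + 1) := by
  have hmem : ∀ t ∈ Icc (0 : ℝ) 1, (t : ℂ) * z ∈ ball (0 : ℂ) r := by
    intro t ht
    rw [mem_ball_zero_iff] at hz ⊢
    rw [norm_mul, Complex.norm_of_nonneg ht.1]
    exact (mul_le_of_le_one_left (norm_nonneg z) ht.2).trans_lt hz
  have hderiv : ∀ t ∈ Icc (0 : ℝ) 1,
      HasDerivAt (fun s : ℝ ↦ f (s * z)) (z • f' (t * z)) t := by
    intro t ht
    have h : HasDerivAt (fun s : ℝ ↦ (s : ℂ) * z) z t := by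
      simpa using (Complex.ofRealCLM.hasDerivAt (x := t)).mul_const z
    exact (hf _ (hmem t ht)).scomp t h
  have hB : ∀ t : ℝ, HasDerivAt (fun s : ℝ ↦ C * ‖z‖ ^ (k + 1) / (k + 1) * s ^ (k + 1))
      (C * ‖z‖ ^ (k + 1) * t ^ k) t := by
    intro t
    convert! (hasDerivAt_pow (k + 1) t).const_mul (C * ‖z‖ ^ (k + 1) / (k + 1)) using 1
    have : (k : ℝ) + 1 ≠ 0 := by positivity
    push_cast
    field_simp
  have key := image_norm_le_of_norm_deriv_right_le_deriv_boundary
    (fun t ht ↦ (hderiv t ht).continuousAt.continuousWithinAt)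
    (fun t ht ↦ (hderiv t (Ico_subset_Icc_self ht)).hasDerivWithinAt)
    (by simp [hf₀]) hB (fun t ht ↦ by
      have h := bound _ (hmem t (Ico_subset_Icc_self ht))
      rw [norm_mul, Complex.norm_of_nonneg ht.1] at h
      rw [norm_smul]
      calc ‖z‖ * ‖f' (t * z)‖ ≤ ‖z‖ * (C * (t * ‖z‖) ^ k) := by gcongr
        _ = C * ‖z‖ ^ (k + 1) * t ^ k := by ring) (right_mem_Icc.2 zero_le_one)
  simpa using key

variable [CompleteSpace E]

/-- The successive corrections in the Picard iteration for `u' = L u`, `u 0 = e`. -/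
theorem exists_picard_sequence {L : ℂ → E →L[ℂ] E} {R : ℝ}
    (hL : DifferentiableOn ℂ L (ball 0 R)) (e : E) :
    ∃ u : ℕ → ℂ → E, (∀ z, u 0 z = e) ∧ (∀ k, u (k + 1) 0 = 0) ∧
      ∀ k, ∀ z ∈ ball (0 : ℂ) R, HasDerivAt (u (k + 1)) (L z (u k z)) z := by
  have step : ∀ f : {f : ℂ → E // DifferentiableOn ℂ f (ball 0 R)},
      ∃ g : {f : ℂ → E // DifferentiableOn ℂ f (ball 0 R)},
        g.1 0 = 0 ∧ ∀ z ∈ ball (0 : ℂ) R, HasDerivAt g.1 (L z (f.1 z)) z := by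
    intro f
    obtain ⟨g, hg₀, hg⟩ := (hL.clm_apply f.2).isExactOn_ball.with_val_at 0 0
    exact ⟨⟨g, fun z hz ↦ (hg z hz).differentiableAt.differentiableWithinAt⟩, hg₀, hg⟩
  choose next hnext₀ hnext using step
  refine ⟨fun k ↦ (next^[k] ⟨fun _ ↦ e, differentiableOn_const e⟩).1, fun z ↦ rfl,
    fun k ↦ ?_, fun k z hz ↦ ?_⟩
  · simp only [Function.iterate_succ_apply', hnext₀]
  · simpa only [Function.iterate_succ_apply'] using hnext _ z hz

/-- A linear differential equation with holomorphic coefficients on a disc has a solution with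
prescribed value at the centre. -/
theorem exists_hasDerivAt_clm_apply_on_ball {L : ℂ → E →L[ℂ] E} {R : ℝ}
    (hL : DifferentiableOn ℂ L (ball 0 R)) (e : E) :
    ∃ g : ℂ → E, g 0 = e ∧ ∀ z ∈ ball (0 : ℂ) R, HasDerivAt g (L z (g z)) z := by
  obtain ⟨u, hu₀, hu_zero, hu⟩ := exists_picard_sequence hL e
  refine ⟨fun z ↦ e + ∑' k, u (k + 1) z, by simp [hu_zero], fun z hz ↦ ?_⟩
  obtain ⟨r, hzr, hrR⟩ := exists_between (mem_ball_zero_iff.1 hz)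
  have hr : 0 < r := (norm_nonneg z).trans_lt hzr
  obtain ⟨M, hM⟩ := (isCompact_closedBall (0 : ℂ) r).exists_bound_of_continuousOn
    (hL.continuousOn.mono (closedBall_subset_ball hrR))
  have hM₀ : 0 ≤ M := (norm_nonneg _).trans (hM 0 (mem_closedBall_self hr.le))
  have hsub : ball (0 : ℂ) r ⊆ ball 0 R := ball_subset_ball hrR.le
  have hLu : ∀ k, ∀ w ∈ ball (0 : ℂ) r, ‖L w (u k w)‖ ≤ M * ‖u k w‖ := fun k w hw ↦
    (L w).le_of_opNorm_le (hM w (ball_subset_closedBall hw)) _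
  have hbound : ∀ k, ∀ w ∈ ball (0 : ℂ) r, ‖u k w‖ ≤ ‖e‖ * M ^ k / k ! * ‖w‖ ^ k := by
    intro k
    induction k with
    | zero => simp [hu₀]
    | succ k ih =>
      intro w hw
      have h := norm_le_of_norm_hasDerivAt_le_pow (k := k) (C := M * (‖e‖ * M ^ k / k !))
        (fun v hv ↦ hu k v (hsub hv)) (hu_zero k)
        (fun v hv ↦ (hLu k v hv).trans (by
          rw [mul_assoc]; exact mul_le_mul_of_nonneg_left (ih v hv) hM₀)) hw
      refine h.trans_eq ?_
      rw [Nat.factorial_succ]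
      push_cast
      field_simp
      ring
  have hbound' : ∀ k, ∀ w ∈ ball (0 : ℂ) r, ‖u k w‖ ≤ ‖e‖ * ((M * r) ^ k / k !) := by
    intro k w hw
    refine (hbound k w hw).trans ?_
    calc ‖e‖ * M ^ k / k ! * ‖w‖ ^ k ≤ ‖e‖ * M ^ k / k ! * r ^ k := by
          gcongr
          exact (mem_ball_zero_iff.1 hw).le
      _ = ‖e‖ * ((M * r) ^ k / k !) := by rw [mul_pow]; ring
  have hsum : Summable fun k : ℕ ↦ ‖e‖ * ((M * r) ^ k / k !) :=
    (Real.summable_pow_div_factorial _).mul_left _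
  have hz' : z ∈ ball (0 : ℂ) r := mem_ball_zero_iff.2 hzr
  have hsumz : Summable fun k ↦ u k z := .of_norm_bounded hsum fun k ↦ hbound' k z hz'
  have hderiv := hasDerivAt_tsum_of_isPreconnected (hsum.mul_left M) isOpen_ball
    (convex_ball (0 : ℂ) r).isPreconnected (fun k w hw ↦ hu k w (hsub hw))
    (fun k w hw ↦ (hLu k w hw).trans (mul_le_mul_of_nonneg_left (hbound' k w hw) hM₀))
    (mem_ball_self hr) (by simp [hu_zero]) hz'
  rw [← (L z).map_tsum hsumz, hsumz.tsum_eq_zero_add, hu₀] at hderiv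
  exact hderiv.const_add e

/-- In a complete normed algebra, the equation `h' = -A h`, `h 0 = 1` has a solution on the disc,
and it is a right inverse of every solution of `g' = g A`, `g 0 = 1`. -/
theorem exists_mul_eq_one_of_hasDerivAt_mul {R : Type*} [NormedRing R] [NormedAlgebra ℂ R]
    [CompleteSpace R] {A : ℂ → R} {r : ℝ} (hA : DifferentiableOn ℂ A (ball 0 r)) :
    ∃ h : ℂ → R, ∀ g : ℂ → R, g 0 = 1 →
      (∀ z ∈ ball (0 : ℂ) r, HasDerivAt g (g z * A z) z) →
      ∀ z ∈ ball (0 : ℂ) r, g z * h z = 1 := by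
  obtain ⟨h, hh₀, hh⟩ := exists_hasDerivAt_clm_apply_on_ball
    (L := fun z ↦ ContinuousLinearMap.mul ℂ R (-A z))
    ((ContinuousLinearMap.mul ℂ R).differentiable.comp_differentiableOn hA.neg) 1
  refine ⟨h, fun g hg₀ hg z hz ↦ ?_⟩
  have hd : ∀ w ∈ ball (0 : ℂ) r, HasDerivAt (fun w ↦ g w * h w) 0 w := by
    intro w hw
    have := (hg w hw).fun_mul (hh w hw)
    simpa [mul_assoc] using this
  have hconst := isOpen_ball.is_const_of_deriv_eq_zero (convex_ball (0 : ℂ) r).isPreconnected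
    (fun w hw ↦ (hd w hw).differentiableAt.differentiableWithinAt)
    (fun w hw ↦ (hd w hw).deriv) hz (mem_ball_self (pos_of_mem_ball hz))
  simpa [hg₀, hh₀] using hconst

/-- In a complete normed algebra, the equation `g' = g A`, `g 0 = 1` has a solution on the disc. -/
theorem exists_hasDerivAt_mul_on_ball {R : Type*} [NormedRing R] [NormedAlgebra ℂ R]
    [CompleteSpace R] {A : ℂ → R} {r : ℝ} (hA : DifferentiableOn ℂ A (ball 0 r)) :
    ∃ g : ℂ → R, g 0 = 1 ∧ ∀ z ∈ ball (0 : ℂ) r, HasDerivAt g (g z * A z) z :=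
  exists_hasDerivAt_clm_apply_on_ball
    (L := fun z ↦ (ContinuousLinearMap.mul ℂ R).flip (A z))
    ((ContinuousLinearMap.mul ℂ R).flip.differentiable.comp_differentiableOn hA) 1

end LinearODE

/-- Holomorphic solution of the linear matrix ODE `g' = g·A` on the open unit disc:
there is a holomorphic `g` with `g(0) = 1`, `g'(z) = g(z)·A(z)` and `g(z)` invertible
for all `z` in the disc, and it is unique on the disc. -/
theorem holomorphic_linear_ode_on_disc (n : ℕ)
    (A : ℂ → Matrix (Fin n) (Fin n) ℂ)
    (hA : DifferentiableOn ℂ A (Metric.ball 0 1)) :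
    ∃ g : ℂ → Matrix (Fin n) (Fin n) ℂ,
      DifferentiableOn ℂ g (Metric.ball 0 1) ∧
      g 0 = 1 ∧
      (∀ z ∈ Metric.ball (0 : ℂ) 1, HasDerivAt g (g z * A z) z) ∧
      (∀ z ∈ Metric.ball (0 : ℂ) 1, IsUnit (g z)) ∧
      ∀ g₁ g₂ : ℂ → Matrix (Fin n) (Fin n) ℂ,
        DifferentiableOn ℂ g₁ (Metric.ball 0 1) → g₁ 0 = 1 →
        (∀ z ∈ Metric.ball (0 : ℂ) 1, HasDerivAt g₁ (g₁ z * A z) z) →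
        DifferentiableOn ℂ g₂ (Metric.ball 0 1) → g₂ 0 = 1 →
        (∀ z ∈ Metric.ball (0 : ℂ) 1, HasDerivAt g₂ (g₂ z * A z) z) →
        Set.EqOn g₁ g₂ (Metric.ball 0 1) := by
  have : CompleteSpace (Matrix (Fin n) (Fin n) ℂ) := FiniteDimensional.complete ℂ _
  obtain ⟨g, hg₀, hg⟩ := exists_hasDerivAt_mul_on_ball hA
  obtain ⟨h, hh⟩ := exists_mul_eq_one_of_hasDerivAt_mul hA
  refine ⟨g, fun z hz ↦ (hg z hz).differentiableAt.differentiableWithinAt, hg₀, hg,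
    fun z hz ↦ .of_mul_eq_one (h z) (hh g hg₀ hg z hz), ?_⟩
  intro g₁ g₂ _ hg₁₀ hg₁ _ hg₂₀ hg₂ z hz
  exact left_inv_eq_right_inv (hh g₁ hg₁₀ hg₁ z hz) (mul_eq_one_comm.1 (hh g₂ hg₂₀ hg₂ z hz))
end

section
/- For every integer p ≥ 1, let c be the cyclic permutation of Fin (2p−1) given by i ↦ i+1 (mod 2p−1) (finRotate (2p−1)). Then there exists a permutation σ of Fin (2p−1) with σ · c · σ⁻¹ = c⁻¹ and sign(σ) = (−1)^{p+1}. (Used in the paper: a cycle of length 2p−1 is conjugate to its inverse by a permutation of sign (−1)^{p+1}.) -/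
theorem Fin.revPerm_conj_finRotate (n : ℕ) :
    Fin.revPerm * finRotate n * Fin.revPerm⁻¹ = (finRotate n)⁻¹ := by
  cases n with
  | zero => exact Subsingleton.elim _ _
  | succ n =>
    rw [eq_inv_iff_mul_eq_one]
    ext i
    simp only [Equiv.Perm.mul_apply, Equiv.Perm.inv_def, Fin.revPerm_symm, Fin.revPerm_apply,
      Equiv.Perm.one_apply, coe_finRotate, Fin.val_rev, Fin.ext_iff, Fin.val_last]
    split_ifs <;> lia

theorem Fin.sign_revPerm_odd (k : ℕ) :
    Equiv.Perm.sign (Fin.revPerm : Equiv.Perm (Fin (2 * k + 1))) = (-1) ^ k := by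
  have hsq : (Fin.revPerm : Equiv.Perm (Fin (2 * k + 1))) ^ 2 = 1 := by
    ext i
    simp [pow_two]
  have hfix : Function.fixedPoints (Fin.revPerm : Equiv.Perm (Fin (2 * k + 1))) =
      {⟨k, by lia⟩} := by
    ext i
    simp [Function.IsFixedPt, Fin.ext_iff, Fin.val_rev]
    lia
  have hcard : Fintype.card (Function.fixedPoints
      (Fin.revPerm : Equiv.Perm (Fin (2 * k + 1)))) = 1 := by
    rw [← Nat.card_eq_fintype_card, hfix]
    simp
  rw [Equiv.Perm.sign_of_pow_two_eq_one hsq, hcard]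
  simp

/-- A cycle of length `2p − 1` is conjugate to its inverse by a permutation of sign
`(−1)^(p+1)`: there is `σ` with `σ ∘ c ∘ σ⁻¹ = c⁻¹` and `sign σ = (−1)^(p+1)`, where
`c = finRotate (2p − 1)`. -/
theorem cycle_conjugate_to_inverse_sign (p : ℕ) (hp : 1 ≤ p) :
    ∃ σ : Equiv.Perm (Fin (2 * p - 1)),
      σ * finRotate (2 * p - 1) * σ⁻¹ = (finRotate (2 * p - 1))⁻¹ ∧
      Equiv.Perm.sign σ = (-1) ^ (p + 1) := by
  obtain ⟨k, rfl⟩ : ∃ k, p = k + 1 := ⟨p - 1, by lia⟩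
  refine ⟨Fin.revPerm, Fin.revPerm_conj_finRotate _, ?_⟩
  rw [show 2 * (k + 1) - 1 = 2 * k + 1 by lia, Fin.sign_revPerm_odd]
  simp [pow_succ]
end

section
/- Injectivity of ℓ^∞(I): let W be a real Banach space, V ⊆ W a (closed) subspace, I a set, and f : V → ℓ^∞(I) a continuous linear map. Then there exists a continuous linear map g : W → ℓ^∞(I) extending f (g restricted to V equals f) with operator norm ‖g‖ = ‖f‖. -/
open scoped ENNReal

/-- Injectivity of `ℓ^∞(I)`: a continuous linear map from a subspace `V` of a real Banach
space `W` to `ℓ^∞(I)` extends to all of `W` with the same operator norm. -/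
theorem linfty_injective_extension
    (W : Type*) [NormedAddCommGroup W] [NormedSpace ℝ W] [CompleteSpace W]
    (V : Submodule ℝ W) (I : Type*) (f : V →L[ℝ] lp (fun _ : I => ℝ) ∞) :
    ∃ g : W →L[ℝ] lp (fun _ : I => ℝ) ∞, (∀ v : V, g v = f v) ∧ ‖g‖ = ‖f‖ := by
  have coord_extension (i : I) :
      ∃ φ : StrongDual ℝ W, (∀ v : V, φ v = f v i) ∧ ‖φ‖ ≤ ‖f‖ := by
    let ψ : StrongDual ℝ V := LinearMap.mkContinuous
      { toFun := fun v => f v i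
        map_add' := fun v w => by simp
        map_smul' := fun c v => by simp } ‖f‖ fun v =>
          (lp.norm_apply_le_norm ENNReal.top_ne_zero (f v) i).trans (f.le_opNorm v)
    obtain ⟨φ, hφ, hnorm⟩ := exists_extension_norm_eq V ψ
    exact ⟨φ, hφ, hnorm.trans_le (LinearMap.mkContinuous_norm_le _ (norm_nonneg f) _)⟩
  choose φ hφ hnorm using coord_extension
  have bound (w : W) (i : I) : ‖φ i w‖ ≤ ‖f‖ * ‖w‖ := (φ i).le_of_opNorm_le (hnorm i) w
  let g₀ : W →ₗ[ℝ] lp (fun _ : I => ℝ) ∞ :=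
    { toFun := fun w => ⟨fun i => φ i w,
        memℓp_infty ⟨‖f‖ * ‖w‖, Set.forall_mem_range.2 (bound w)⟩⟩
      map_add' := fun v w => by ext i; exact map_add (φ i) v w
      map_smul' := fun c w => by ext i; exact map_smul (φ i) c w }
  let g : W →L[ℝ] lp (fun _ : I => ℝ) ∞ := g₀.mkContinuous ‖f‖ fun w =>
    lp.norm_le_of_forall_le (by positivity) (bound w)
  have hg (v : V) : g v = f v := by
    ext i
    exact hφ i v
  refine ⟨g, hg, le_antisymm (g₀.mkContinuous_norm_le (norm_nonneg f) _) ?_⟩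
  refine f.opNorm_le_bound (norm_nonneg g) fun v => ?_
  rw [← hg]
  exact g.le_opNorm v
end

section
/- Splitting lemma for quasi-isomorphisms commuting with a doubling operator (the key step in Theorem 2.20 of the paper): let R be a ring and let L = L₁ ⊕ L₂ and S = S₁ ⊕ S₂ be chain complexes of R-modules given as degreewise direct sums with differentials preserving the summands (biproducts of complexes). Let f : L → S be a quasi-isomorphism of chain complexes, and let T_L = T_{L,1} ⊕ T_{L,2} : L → L and T_S = T_{S,1} ⊕ T_{S,2} : S → S be chain maps preserving the decompositions, such that: (a) f ∘ T_L is chain homotopic to T_S ∘ f; (b) T_{L,1} − 2·id_{L₁} and T_{S,1} − 2·id_{S₁} are chain homotopic to zero; (c) T_{L,2} − 2·id_{L₂} and T_{S,2} − 2·id_{S₂} are chain homotopy equivalences. Then the component f₁₁ : L₁ → S₁ of f (the composite of the inclusion L₁ → L, f, and the projection S → S₁) is a quasi-isomorphism. -/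
open CategoryTheory CategoryTheory.Limits

/-- If an additive functor inverts a morphism between biproducts and kills its off-diagonal
components, then it inverts the upper left component. -/
lemma isIso_map_inl_comp_fst_of_map_offDiagonal_eq_zero
    {C D : Type*} [Category* C] [Category* D] [Preadditive C] [Preadditive D]
    [HasBinaryBiproducts C] (F : C ⥤ D) [F.Additive] {X₁ X₂ Y₁ Y₂ : C}
    (f : X₁ ⊞ X₂ ⟶ Y₁ ⊞ Y₂) [IsIso (F.map f)]
    (h₁₂ : F.map (biprod.inl ≫ f ≫ biprod.snd) = 0)
    (h₂₁ : F.map (biprod.inr ≫ f ≫ biprod.fst) = 0) :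
    IsIso (F.map (biprod.inl ≫ f ≫ biprod.fst)) := by
  have total (X Y : C) : F.map (biprod.fst : X ⊞ Y ⟶ X) ≫ F.map biprod.inl =
      𝟙 _ - F.map biprod.snd ≫ F.map biprod.inr := by
    rw [eq_sub_iff_add_eq, ← F.map_comp, ← F.map_comp, ← F.map_add, biprod.total, F.map_id]
  have inl_fst (X Y : C) : F.map (biprod.inl : X ⟶ X ⊞ Y) ≫ F.map biprod.fst = 𝟙 _ := by
    rw [← F.map_comp, biprod.inl_fst, F.map_id]
  simp only [F.map_comp] at h₁₂ h₂₁ ⊢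
  refine ⟨F.map biprod.inl ≫ inv (F.map f) ≫ F.map biprod.fst, ?_, ?_⟩
  · simp only [Category.assoc]
    rw [reassoc_of% total]
    simp only [Preadditive.sub_comp, Preadditive.comp_sub, Category.id_comp, Category.assoc,
      IsIso.hom_inv_id_assoc, inl_fst, reassoc_of% h₁₂, zero_comp, sub_zero]
  · simp only [Category.assoc]
    rw [reassoc_of% total]
    simp only [Preadditive.sub_comp, Category.id_comp, Category.assoc,
      IsIso.inv_hom_id_assoc, inl_fst, h₂₁, comp_zero, sub_zero]

/-- Splitting lemma for quasi-isomorphisms commuting with a doubling operator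
(the key step in Theorem 2.20 of the paper): if `f : L₁ ⊞ L₂ ⟶ S₁ ⊞ S₂` is a
quasi-isomorphism of chain complexes intertwining (up to homotopy) diagonal operators
`T_L = T_{L,1} ⊕ T_{L,2}` and `T_S = T_{S,1} ⊕ T_{S,2}` such that `T_{L,1} − 2`,
`T_{S,1} − 2` are null-homotopic while `T_{L,2} − 2`, `T_{S,2} − 2` are homotopy
equivalences, then the component `f₁₁ : L₁ ⟶ S₁` is a quasi-isomorphism. -/
theorem component_quasiIso_of_doubling
    (R : Type*) [Ring R]
    (L₁ L₂ S₁ S₂ : HomologicalComplex (ModuleCat R) (ComplexShape.down ℤ))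
    (f : L₁ ⊞ L₂ ⟶ S₁ ⊞ S₂) [QuasiIso f]
    (TL₁ : L₁ ⟶ L₁) (TL₂ : L₂ ⟶ L₂) (TS₁ : S₁ ⟶ S₁) (TS₂ : S₂ ⟶ S₂)
    (ha : Nonempty (Homotopy (biprod.map TL₁ TL₂ ≫ f) (f ≫ biprod.map TS₁ TS₂)))
    (hbL : Nonempty (Homotopy (TL₁ - 2 • 𝟙 L₁) 0))
    (hbS : Nonempty (Homotopy (TS₁ - 2 • 𝟙 S₁) 0))
    (hcL : ∃ e : HomotopyEquiv L₂ L₂, e.hom = TL₂ - 2 • 𝟙 L₂)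
    (hcS : ∃ e : HomotopyEquiv S₂ S₂, e.hom = TS₂ - 2 • 𝟙 S₂) :
    QuasiIso (biprod.inl ≫ f ≫ biprod.fst) := by
  obtain ⟨ha⟩ := ha
  obtain ⟨hbL⟩ := hbL
  obtain ⟨hbS⟩ := hbS
  obtain ⟨eL, heL⟩ := hcL
  obtain ⟨eS, heS⟩ := hcS
  rw [quasiIso_iff]
  intro n
  rw [quasiIsoAt_iff_isIso_homologyMap]
  let H := HomologicalComplex.homologyFunctor (ModuleCat R) (ComplexShape.down ℤ) n
  have : IsIso (H.map f) := inferInstanceAs (IsIso (HomologicalComplex.homologyMap f n))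
  have hL₁ : H.map (TL₁ - 2 • 𝟙 L₁) = 0 := (hbL.homologyMap_eq n).trans (H.map_zero _ _)
  have hS₁ : H.map (TS₁ - 2 • 𝟙 S₁) = 0 := (hbS.homologyMap_eq n).trans (H.map_zero _ _)
  have hL₂ : IsIso (H.map (TL₂ - 2 • 𝟙 L₂)) := by
    rw [← heL]
    exact (eL.toHomologyIso n).isIso_hom
  have hS₂ : IsIso (H.map (TS₂ - 2 • 𝟙 S₂)) := by
    rw [← heS]
    exact (eS.toHomologyIso n).isIso_hom
  have comm : H.map (biprod.map TL₁ TL₂ ≫ f) = H.map (f ≫ biprod.map TS₁ TS₂) :=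
    ha.homologyMap_eq n
  refine isIso_map_inl_comp_fst_of_map_offDiagonal_eq_zero H f ?_ ?_
  · rw [← cancel_mono (H.map (TS₂ - 2 • 𝟙 S₂)), zero_comp]
    calc
      _ = H.map biprod.inl ≫ H.map (f ≫ biprod.map TS₁ TS₂) ≫ H.map biprod.snd
            - H.map (2 • (biprod.inl ≫ f ≫ biprod.snd)) := by
        simp only [← H.map_comp, ← H.map_sub]; simp
      _ = H.map (TL₁ - 2 • 𝟙 L₁) ≫ H.map (biprod.inl ≫ f ≫ biprod.snd) := by
        rw [← comm]; simp only [← H.map_comp, ← H.map_sub]; simp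
      _ = 0 := by rw [hL₁, zero_comp]
  · rw [← cancel_epi (H.map (TL₂ - 2 • 𝟙 L₂)), comp_zero]
    calc
      _ = H.map biprod.inr ≫ H.map (biprod.map TL₁ TL₂ ≫ f) ≫ H.map biprod.fst
            - H.map (2 • (biprod.inr ≫ f ≫ biprod.fst)) := by
        simp only [← H.map_comp, ← H.map_sub]; simp
      _ = H.map (biprod.inr ≫ f ≫ biprod.fst) ≫ H.map (TS₁ - 2 • 𝟙 S₁) := by
        rw [comm]; simp only [← H.map_comp, ← H.map_sub]; simp
      _ = 0 := by rw [hS₁, comp_zero]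
end
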